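/- Let n ≥ 2. There exists a bounded open convex set Ω₀ ⊆ ℝ^n with nonempty interior such that for every bounded open convex set Ω ⊆ ℝ^n with nonempty interior one has λ(Ω₀) ≤ λ(Ω); that is, the infimum of λ over the class of bounded open convex sets is attained. -/

import Mathlib

open MeasureTheory Metric Set Real Bornology

noncomputable section

/-- Volume (Lebesgue measure) of a set in `ℝⁿ`. -/
def vol (n : ℕ) (Ω : Set (EuclideanSpace ℝ (Fin n))) : ℝ :=
  (volume Ω).toReal

/-- Surface area: the `(n-1)`-dimensional Hausdorff measure of the topological boundary. -/
def perim (n : ℕ) (Ω : Set (EuclideanSpace ℝ (Fin n))) : ℝ :=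
  (μH[(n : ℝ) - 1] (frontier Ω)).toReal

/-- Boundary momentum `W(Ω) = ∫_{∂Ω} |x|² dH^{n-1}(x)`. -/
def bmom (n : ℕ) (Ω : Set (EuclideanSpace ℝ (Fin n))) : ℝ :=
  ∫ x in frontier Ω, ‖x‖ ^ 2 ∂μH[(n : ℝ) - 1]

/-- The scale invariant functional `λ(Ω) = W(Ω) / (P(Ω) V(Ω)^{2/n})`. -/
def lamFun (n : ℕ) (Ω : Set (EuclideanSpace ℝ (Fin n))) : ℝ :=
  bmom n Ω / (perim n Ω * vol n Ω ^ ((2 : ℝ) / n))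

/-- `ω_n`: the Lebesgue measure of the unit ball of `ℝⁿ`. -/
def unitBallVol (n : ℕ) : ℝ :=
  (volume (ball (0 : EuclideanSpace ℝ (Fin n)) 1)).toReal

section Projection

variable {F : Type*} [NormedAddCommGroup F] [InnerProductSpace ℝ F] [CompleteSpace F]

/-- The nearest point map onto a closed convex set. -/
theorem exists_nearest_point_map {A : Set F} (hc : IsClosed A) (hA : Convex ℝ A)
    (hne : A.Nonempty) :
    ∃ p : F → F, LipschitzWith 1 p ∧ (∀ x, p x ∈ A) ∧ (∀ x ∈ A, p x = x) ∧
      ∀ x, ∀ a ∈ A, inner ℝ (x - p x) (a - p x) ≤ 0 := by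
  choose p hp hmin using exists_norm_eq_iInf_of_complete_convex hne hc.isComplete hA
  have key : ∀ x, ∀ a ∈ A, inner ℝ (x - p x) (a - p x) ≤ 0 := fun x =>
    (norm_eq_iInf_iff_real_inner_le_zero hA (hp x)).1 (hmin x)
  refine ⟨p, ?_, hp, ?_, key⟩
  · refine LipschitzWith.of_dist_le_mul fun x y => ?_
    rw [NNReal.coe_one, one_mul, dist_eq_norm, dist_eq_norm]
    have h1 := key x (p y) (hp y)
    have h2 := key y (p x) (hp x)
    have h3 : ‖p x - p y‖ * ‖p x - p y‖ ≤ inner ℝ (x - y) (p x - p y) := by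
      rw [← real_inner_self_eq_norm_mul_norm]
      have e : inner ℝ (x - y) (p x - p y) - inner ℝ (p x - p y) (p x - p y) =
          -inner ℝ (x - p x) (p y - p x) - inner ℝ (y - p y) (p x - p y) := by
        rw [← neg_sub (p x) (p y), inner_neg_right, neg_neg, ← inner_sub_left, ← inner_sub_left]
        congr 1
        abel
      linarith
    have h4 := h3.trans (real_inner_le_norm _ _)
    by_contra! h
    have : 0 ≤ ‖x - y‖ := norm_nonneg _
    nlinarith
  · intro x hx
    have := key x x hx
    rw [real_inner_self_nonpos, sub_eq_zero] at this
    exact this.symm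

omit [CompleteSpace F] in
/-- A ray issued from a point of a bounded set meets the frontier of that set. -/
theorem exists_add_smul_mem_frontier {B : Set F} (hB : IsBounded B) {a v : F} (ha : a ∈ B)
    (hv : v ≠ 0) : ∃ t : ℝ, 0 ≤ t ∧ a + t • v ∈ frontier B := by
  by_contra! h
  have hcont : Continuous fun t : ℝ => a + t • v := by fun_prop
  have hpre := (isPreconnected_Ici (a := (0 : ℝ))).image _ hcont.continuousOn
  have hsub : (fun t : ℝ => a + t • v) '' Ici 0 ⊆ interior B ∪ (closure B)ᶜ := by
    rintro _ ⟨t, ht, rfl⟩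
    by_contra hx
    rw [mem_union, not_or, mem_compl_iff, not_not] at hx
    exact h t ht ⟨hx.2, hx.1⟩
  have hmem : ∀ t : ℝ, 0 ≤ t → a + t • v ∈ (fun t : ℝ => a + t • v) '' Ici 0 :=
    fun t ht => ⟨t, ht, rfl⟩
  have ha0 : a ∈ (fun t : ℝ => a + t • v) '' Ici 0 := by simpa using hmem 0 le_rfl
  obtain ⟨R, hR⟩ := hB.closure.subset_closedBall a
  have hv' : 0 < ‖v‖ := norm_pos_iff.2 hv
  have hfar : a + ((|R| + 1) / ‖v‖) • v ∉ closure B := by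
    intro hx
    have h1 := hR hx
    rw [mem_closedBall, dist_eq_norm, add_sub_cancel_left, norm_smul, norm_div, norm_norm,
      div_mul_cancel₀ _ hv'.ne', Real.norm_of_nonneg (by positivity)] at h1
    linarith [le_abs_self R]
  have haint : a ∈ interior B := by
    rcases hsub ha0 with h1 | h1
    · exact h1
    · exact absurd (subset_closure ha) h1
  obtain ⟨x, -, hx1, hx2⟩ := hpre _ _ isOpen_interior isClosed_closure.isOpen_compl hsub
    ⟨a, ha0, haint⟩ ⟨_, hmem _ (by positivity), hfar⟩
  exact hx2 (subset_closure (interior_subset hx1))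

/-- The nearest point map onto a convex set `A` maps the frontier of any bounded set containing `A`
onto the frontier of `A`. -/
theorem exists_map_frontier_superset {A : Set F} (hc : IsClosed A) (hA : Convex ℝ A)
    (hne : (interior A).Nonempty) :
    ∃ p : F → F, LipschitzWith 1 p ∧ (∀ x ∈ A, p x = x) ∧
      ∀ B, IsBounded B → A ⊆ B → frontier A ⊆ p '' frontier B := by
  obtain ⟨p, hlip, hmem, hfix, hp⟩ :=
    exists_nearest_point_map hc hA (hne.mono interior_subset)
  refine ⟨p, hlip, hfix, fun B hB hAB a ha => ?_⟩
  obtain ⟨f, hf⟩ := geometric_hahn_banach_open_point hA.interior isOpen_interior ha.2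
  have hf' : ∀ x ∈ A, f x ≤ f a := fun x hx => by
    have : x ∈ closure (interior A) := by
      rw [hA.closure_interior_eq_closure_of_nonempty_interior hne]
      exact subset_closure hx
    exact closure_minimal (fun y hy => (hf y hy).le)
      (isClosed_le f.continuous continuous_const) this
  have haA : a ∈ A := hc.frontier_subset ha
  set v := (InnerProductSpace.toDual ℝ F).symm f with hv
  have hfv : ∀ x, f x = inner ℝ v x := fun x => by
    rw [hv, InnerProductSpace.toDual_symm_apply]
  have hv0 : v ≠ 0 := by
    intro h0
    obtain ⟨y, hy⟩ := hne
    have := hf y hy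
    simp [hfv, h0] at this
  obtain ⟨t, ht, hmemt⟩ := exists_add_smul_mem_frontier hB (hAB haA) hv0
  refine ⟨_, hmemt, ?_⟩
  have h1 := hp (a + t • v) a haA
  have h2 := hf' _ (hmem (a + t • v))
  set w := p (a + t • v)
  rw [hfv, hfv] at h2
  have h3 : a + t • v - w = (a - w) + t • v := by abel
  rw [h3, inner_add_left, inner_smul_left, inner_sub_right v] at h1
  have h4 : inner ℝ (a - w) (a - w) ≤ 0 := by
    have : 0 ≤ t * (inner ℝ v a - inner ℝ v w) := mul_nonneg ht (by linarith)
    simp only [conj_trivial] at h1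
    linarith
  rw [real_inner_self_nonpos, sub_eq_zero] at h4
  exact h4.symm

/-- The affine homeomorphism `x ↦ s • x + w`. -/
def smulAddHomeo (s : ℝ) (hs : s ≠ 0) (w : F) : F ≃ₜ F :=
  (Homeomorph.smulOfNeZero s hs).trans (Homeomorph.addRight w)

omit [CompleteSpace F] in
theorem smulAddHomeo_apply (s : ℝ) (hs : s ≠ 0) (w x : F) :
    smulAddHomeo s hs w x = s • x + w := rfl

omit [CompleteSpace F] in
theorem smulAddHomeo_symm_apply (s : ℝ) (hs : s ≠ 0) (w x : F) :
    (smulAddHomeo s hs w).symm x = s⁻¹ • (x - w) := by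
  rw [Homeomorph.symm_apply_eq, smulAddHomeo_apply, smul_inv_smul₀ hs, sub_add_cancel]

omit [CompleteSpace F] in
theorem lipschitzWith_smulAddHomeo_symm {s : ℝ} (hs : 0 < s) (w : F) :
    LipschitzWith s⁻¹.toNNReal (smulAddHomeo s hs.ne' w).symm := by
  refine LipschitzWith.of_dist_le_mul fun x y => ?_
  rw [smulAddHomeo_symm_apply, smulAddHomeo_symm_apply, dist_smul₀, dist_sub_right,
    Real.norm_of_nonneg (by positivity), Real.coe_toNNReal _ (by positivity)]

/-- If the image of a convex body `K` under `x ↦ s • x + w` lies in `L`, then the frontier of `K` is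
covered by an `s⁻¹`-Lipschitz image of the frontier of `L`. -/
theorem exists_lipschitz_frontier_cover {K L : Set F} (hc : IsClosed K) (hK : Convex ℝ K)
    (hne : (interior K).Nonempty) (hL : IsBounded L) {s : ℝ} (hs : 0 < s) (w : F)
    (h : ∀ x ∈ K, s • x + w ∈ L) :
    ∃ g : F → F, LipschitzWith s⁻¹.toNNReal g ∧ frontier K ⊆ g '' frontier L ∧
      ((0 : F) ∈ K → ∀ x, ‖g x‖ ≤ s⁻¹ * ‖x - w‖) := by
  obtain ⟨p, hp, hfix, hsup⟩ := exists_map_frontier_superset hc hK hne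
  have hlip := lipschitzWith_smulAddHomeo_symm hs w
  refine ⟨p ∘ (smulAddHomeo s hs.ne' w).symm, ?_, ?_, fun h0 x => ?_⟩
  · simpa using hp.comp hlip
  · rw [image_comp, Homeomorph.image_frontier]
    refine hsup _ (hlip.isBounded_image hL) fun x hx => ⟨s • x + w, h x hx, ?_⟩
    rw [← smulAddHomeo_apply s hs.ne', Homeomorph.symm_apply_apply]
  · have h1 := hp.dist_le_mul ((smulAddHomeo s hs.ne' w).symm x) 0
    rw [hfix 0 h0, dist_zero_right, dist_zero_right, NNReal.coe_one, one_mul,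
      smulAddHomeo_symm_apply, norm_smul, Real.norm_of_nonneg (by positivity)] at h1
    simpa [smulAddHomeo_symm_apply] using h1

/-- A convex body in the unit ball containing a unit vector `y` has its frontier covered by Lipschitz
images of the part of the frontier lying in the half-space `1 / 2 ≤ ⟪y, x⟫`. -/
theorem exists_frontier_cover_halfSpace {K : Set F} (hc : IsClosed K) (hK : Convex ℝ K)
    (hne : (interior K).Nonempty) (hb : K ⊆ closedBall 0 1) {y : F} (hy : y ∈ K)
    (hy1 : ‖y‖ = 1) :
    ∃ g q : F → F, LipschitzWith (4⁻¹ : ℝ)⁻¹.toNNReal g ∧ LipschitzWith 1 q ∧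
      frontier K ⊆ g '' ((frontier K ∩ {x | 1 / 2 ≤ inner ℝ y x}) ∪
        q '' (frontier K ∩ {x | 1 / 2 ≤ inner ℝ y x})) := by
  have hKb : IsBounded K := isBounded_closedBall.subset hb
  have hyy : inner ℝ y y = (1 : ℝ) := by rw [real_inner_self_eq_norm_sq, hy1, one_pow]
  set H : Set F := {x | 1 / 2 ≤ inner ℝ y x} with hH
  have hHc : IsClosed H := isClosed_le continuous_const (by fun_prop)
  obtain ⟨g, hg, hcov, -⟩ := exists_lipschitz_frontier_cover hc hK hne
    (hKb.subset (inter_subset_left (t := H))) (s := 4⁻¹) (by norm_num) ((3 / 4 : ℝ) • y) (by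
      intro x hx
      refine ⟨hK hx hy (by norm_num) (by norm_num) (by norm_num), ?_⟩
      have h1 : |inner ℝ y x| ≤ 1 := by
        refine (abs_real_inner_le_norm y x).trans ?_
        rw [hy1, one_mul]
        simpa using hb hx
      rw [hH, mem_ofPred_eq, inner_add_right, inner_smul_right, inner_smul_right, hyy]
      linarith [(abs_le.1 h1).1])
  set q : F → F := fun x => x - (inner ℝ y x - 1 / 2) • y with hq
  refine ⟨g, q, hg, ?_, hcov.trans (image_mono ?_)⟩
  · refine LipschitzWith.of_dist_le_mul fun x z => ?_
    rw [NNReal.coe_one, one_mul, dist_eq_norm, dist_eq_norm]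
    have h1 : q x - q z = (x - z) - inner ℝ y (x - z) • y := by
      simp only [hq, inner_sub_right, sub_smul]
      abel
    rw [h1]
    refine le_of_sq_le_sq ?_ (norm_nonneg _)
    rw [norm_sub_sq_real, inner_smul_right, norm_smul, hy1, mul_one, Real.norm_eq_abs, sq_abs,
      real_inner_comm y (x - z)]
    nlinarith [sq_nonneg (inner ℝ y (x - z))]
  · intro x hx
    rcases frontier_inter_subset _ _ hx with ⟨h1, h2⟩ | ⟨h1, h2⟩
    · rw [hHc.closure_eq] at h2
      exact Or.inl ⟨h1, h2⟩
    · right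
      rw [hc.closure_eq] at h1
      have hx2 : inner ℝ y x = (1 / 2 : ℝ) :=
        (frontier_le_subset_eq continuous_const (by fun_prop) h2).symm
      obtain ⟨t, ht, hmem⟩ := exists_add_smul_mem_frontier hKb h1
        (v := y) (norm_pos_iff.1 (by rw [hy1]; exact one_pos))
      have h3 : inner ℝ y (x + t • y) = 1 / 2 + t := by
        rw [inner_add_right, inner_smul_right, hyy, hx2, mul_one]
      refine ⟨x + t • y, ⟨hmem, ?_⟩, ?_⟩
      · rw [hH, mem_ofPred_eq, h3]
        linarith
      · simp only [hq, h3]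
        rw [add_sub_cancel_left, add_sub_cancel_right]

omit [CompleteSpace F] in
/-- If every point of `L` is `δ`-close to a convex set `K` containing `closedBall x₀ r`, then
contracting `L` towards `x₀` brings it into `K`. -/
theorem smul_add_mem_of_close_to {K L : Set F} (hK : Convex ℝ K) {x₀ : F} {r δ s : ℝ}
    (hs : 0 < s) (hs1 : s < 1) (hδ : δ ≤ (1 - s) * r) (hr : closedBall x₀ r ⊆ K)
    (hL : ∀ x ∈ L, ∃ k ∈ K, dist x k ≤ δ) {x : F} (hx : x ∈ L) :
    s • x + (1 - s) • x₀ ∈ K := by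
  obtain ⟨k, hk, hxk⟩ := hL x hx
  have h1s : 0 < 1 - s := by linarith
  have hmem : x₀ + (s / (1 - s)) • (x - k) ∈ K := by
    apply hr
    rw [mem_closedBall, dist_eq_norm, add_sub_cancel_left, norm_smul,
      Real.norm_of_nonneg (by positivity), ← dist_eq_norm, div_mul_eq_mul_div, div_le_iff₀ h1s]
    nlinarith [dist_nonneg (x := x) (y := k)]
  have := hK hk hmem hs.le h1s.le (by ring)
  convert this using 1
  rw [smul_add, smul_smul, mul_div_cancel₀ _ h1s.ne', smul_sub]
  abel

/-- If every point of a convex set `K` containing `closedBall x₀ r` is `δ`-close to a closed convex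
set `L`, then contracting `K` towards `x₀` brings it into `L`. -/
theorem smul_add_mem_of_close_from {K L : Set F} (hK : Convex ℝ K) (hLc : IsClosed L)
    (hLconv : Convex ℝ L) (hLne : L.Nonempty) {x₀ : F} {r δ s : ℝ} (hr0 : 0 ≤ r)
    (hs : 0 < s) (hs1 : s < 1) (hδ : δ ≤ (1 - s) * r) (hr : closedBall x₀ r ⊆ K)
    (hKL : ∀ x ∈ K, ∃ l ∈ L, dist x l ≤ δ) {x : F} (hx : x ∈ K) :
    s • x + (1 - s) • x₀ ∈ L := by
  obtain ⟨p, -, hpmem, -, hp⟩ := exists_nearest_point_map hLc hLconv hLne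
  by_contra hz
  set z := s • x + (1 - s) • x₀ with hzdef
  have hv : z - p z ≠ 0 := fun h => hz (by rw [sub_eq_zero.1 h]; exact hpmem z)
  have hv' : 0 < ‖z - p z‖ := norm_pos_iff.2 hv
  set u := ‖z - p z‖⁻¹ • (z - p z) with hu
  have hu1 : ‖u‖ = 1 := by rw [hu, norm_smul, norm_inv, norm_norm, inv_mul_cancel₀ hv'.ne']
  have hx₀ : x₀ + r • u ∈ K := by
    apply hr
    rw [mem_closedBall, dist_eq_norm, add_sub_cancel_left, norm_smul, hu1, mul_one,
      Real.norm_of_nonneg hr0]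
  obtain ⟨l, hl, hdist⟩ := hKL _ (hK hx hx₀ hs.le (by linarith : 0 ≤ 1 - s) (by ring))
  have e : s • x + (1 - s) • (x₀ + r • u) - l = ((1 - s) * r) • u + (z - p z) - (l - p z) := by
    rw [hzdef, smul_add, smul_smul]
    abel
  have h1 : inner ℝ u (l - p z) ≤ 0 := by
    rw [hu, inner_smul_left]
    exact mul_nonpos_of_nonneg_of_nonpos (by simp) (hp z l hl)
  have h2 : inner ℝ u (z - p z) = ‖z - p z‖ := by
    rw [hu, inner_smul_left, real_inner_self_eq_norm_mul_norm, conj_trivial,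
      inv_mul_cancel_left₀ hv'.ne']
  have h3 := real_inner_le_norm u (s • x + (1 - s) • (x₀ + r • u) - l)
  rw [← dist_eq_norm, hu1, one_mul, e, inner_sub_right, inner_add_right, inner_smul_right,
    real_inner_self_eq_norm_sq, hu1, h2] at h3
  linarith

end Projection
section HausdorffMeasure

variable {F : Type*} [NormedAddCommGroup F] [MeasurableSpace F] [BorelSpace F]

theorem hausdorffMeasure_real_le_of_subset_image {d : ℝ} (hd : 0 ≤ d) {S T : Set F} {c : ℝ}
    (hc : 0 ≤ c) {g : F → F} (hg : LipschitzWith c.toNNReal g) (hST : S ⊆ g '' T)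
    (hT : μH[d] T ≠ ⊤) : (μH[d] S).toReal ≤ c ^ d * (μH[d] T).toReal := by
  have h := (measure_mono hST).trans (hg.hausdorffMeasure_image_le hd T)
  have htop : (c.toNNReal : ENNReal) ^ d * μH[d] T ≠ ⊤ :=
    ENNReal.mul_ne_top (ENNReal.rpow_ne_top_of_nonneg hd ENNReal.coe_ne_top) hT
  refine (ENNReal.toReal_mono htop h).trans_eq ?_
  rw [ENNReal.toReal_mul, ← ENNReal.toReal_rpow, ENNReal.coe_toReal, Real.coe_toNNReal _ hc]

theorem setLIntegral_hausdorffMeasure_le_of_subset_image {d : ℝ} (hd : 0 ≤ d) {S T : Set F}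
    {c : NNReal} {g : F → F}
    (hg : LipschitzWith c g) (hST : S ⊆ g '' T) {f : F → ENNReal} (hf : Measurable f) :
    ∫⁻ x in S, f x ∂μH[d] ≤ (c : ENNReal) ^ d * ∫⁻ x in T, f (g x) ∂μH[d] := by
  have hgm : Measurable g := hg.continuous.measurable
  have hle : (μH[d]).restrict S ≤ ((c : ENNReal) ^ d) • ((μH[d]).restrict T).map g := by
    refine Measure.le_iff.2 fun u hu => ?_
    rw [Measure.smul_apply, smul_eq_mul, Measure.map_apply hgm hu, Measure.restrict_apply hu,
      Measure.restrict_apply (hgm hu)]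
    refine (measure_mono ?_).trans (hg.hausdorffMeasure_image_le hd _)
    rintro x ⟨hxu, hxS⟩
    obtain ⟨t, ht, rfl⟩ := hST hxS
    exact ⟨t, ⟨hxu, ht⟩, rfl⟩
  refine (lintegral_mono' hle le_rfl).trans_eq ?_
  rw [lintegral_smul_measure, lintegral_map hf hgm, smul_eq_mul]

theorem integrableOn_norm_sq {μ : Measure F} {T : Set F} (hTm : MeasurableSet T)
    (hT : μ T ≠ ⊤) (hb : IsBounded T) : IntegrableOn (fun x => ‖x‖ ^ 2) T μ := by
  obtain ⟨R, hR⟩ := hb.exists_norm_le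
  refine Measure.integrableOn_of_bounded (M := R ^ 2) hT
    (continuous_norm.pow 2).measurable.aestronglyMeasurable ?_
  filter_upwards [ae_restrict_mem hTm] with x hx
  rw [Real.norm_of_nonneg (by positivity)]
  exact pow_le_pow_left₀ (norm_nonneg _) (hR x hx) 2

theorem setIntegral_norm_sq_le_of_subset_image {d : ℝ} (hd : 0 ≤ d) {S T : Set F}
    (hTm : MeasurableSet T) {c : ℝ} (hc : 0 ≤ c) {g : F → F}
    (hg : LipschitzWith c.toNNReal g) (hST : S ⊆ g '' T) (hT : μH[d] T ≠ ⊤) (hb : IsBounded T)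
    {a b : ℝ} (ha : 0 ≤ a) (hb0 : 0 ≤ b) (hab : ∀ x ∈ T, ‖g x‖ ^ 2 ≤ a * ‖x‖ ^ 2 + b) :
    ∫ x in S, ‖x‖ ^ 2 ∂μH[d] ≤
      c ^ d * (a * ∫ x in T, ‖x‖ ^ 2 ∂μH[d] + b * (μH[d] T).toReal) := by
  have hint := integrableOn_norm_sq hTm hT hb
  have hint2 : IntegrableOn (fun _ : F => b) T μH[d] := integrableOn_const hT
  have hmeas : Measurable fun x : F => ‖x‖ ^ 2 := by fun_prop
  have hnn : 0 ≤ a * ∫ x in T, ‖x‖ ^ 2 ∂μH[d] + b * (μH[d] T).toReal := by positivity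
  have hsum : ∫ x in T, (a * ‖x‖ ^ 2 + b) ∂μH[d] =
      a * ∫ x in T, ‖x‖ ^ 2 ∂μH[d] + b * (μH[d] T).toReal := by
    rw [integral_add (hint.const_mul a) hint2, integral_const_mul, setIntegral_const, smul_eq_mul,
      mul_comm b, Measure.real]
  rw [integral_eq_lintegral_of_nonneg_ae (Filter.Eventually.of_forall fun x => by positivity)
    hmeas.aestronglyMeasurable]
  refine ENNReal.toReal_le_of_le_ofReal (mul_nonneg (Real.rpow_nonneg hc _) hnn) ?_
  refine (setLIntegral_hausdorffMeasure_le_of_subset_image hd hg hST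
    hmeas.ennreal_ofReal).trans ?_
  rw [ENNReal.ofReal_mul (Real.rpow_nonneg hc _), ← ENNReal.ofReal_rpow_of_nonneg hc hd]
  refine mul_le_mul_right ?_ _
  have hint3 : IntegrableOn (fun x : F => a * ‖x‖ ^ 2 + b) T μH[d] := (hint.const_mul a).add hint2
  rw [← hsum, ofReal_integral_eq_lintegral_ofReal hint3
    (Filter.Eventually.of_forall fun x => by positivity)]
  exact setLIntegral_mono' hTm fun x hx => ENNReal.ofReal_le_ofReal (hab x hx)

end HausdorffMeasure
section Functional

open scoped Pointwise Topology

variable {n : ℕ}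

theorem perim_nonneg (K : Set (EuclideanSpace ℝ (Fin n))) : 0 ≤ perim n K := ENNReal.toReal_nonneg

theorem vol_nonneg (K : Set (EuclideanSpace ℝ (Fin n))) : 0 ≤ vol n K := ENNReal.toReal_nonneg

theorem bmom_nonneg (K : Set (EuclideanSpace ℝ (Fin n))) : 0 ≤ bmom n K :=
  integral_nonneg fun _ => by positivity

theorem lamFun_nonneg (K : Set (EuclideanSpace ℝ (Fin n))) : 0 ≤ lamFun n K :=
  div_nonneg (bmom_nonneg K) (mul_nonneg (perim_nonneg K) (Real.rpow_nonneg (vol_nonneg K) _))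

theorem perim_pos_of_lamFun_pos {K : Set (EuclideanSpace ℝ (Fin n))} (h : 0 < lamFun n K) :
    0 < perim n K := by
  refine (perim_nonneg K).lt_of_ne' fun h0 => ?_
  simp [lamFun, h0] at h

theorem vol_pos_of_lamFun_pos (hn : n ≠ 0) {K : Set (EuclideanSpace ℝ (Fin n))}
    (h : 0 < lamFun n K) : 0 < vol n K := by
  refine (vol_nonneg K).lt_of_ne' fun h0 => ?_
  rw [lamFun, h0, Real.zero_rpow (by positivity), mul_zero, div_zero] at h
  exact h.false

theorem hausdorffMeasure_frontier_ne_top_of_lamFun_pos {K : Set (EuclideanSpace ℝ (Fin n))}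
    (h : 0 < lamFun n K) : μH[(n : ℝ) - 1] (frontier K) ≠ ⊤ := fun h0 => by
  simpa [perim, h0] using perim_pos_of_lamFun_pos h

theorem bmom_eq_lamFun_mul (hn : n ≠ 0) {K : Set (EuclideanSpace ℝ (Fin n))}
    (h : 0 < lamFun n K) : bmom n K = lamFun n K * (perim n K * vol n K ^ ((2 : ℝ) / n)) := by
  have h1 := perim_pos_of_lamFun_pos h
  have h2 := Real.rpow_pos_of_pos (vol_pos_of_lamFun_pos hn h) ((2 : ℝ) / n)
  rw [lamFun, div_mul_cancel₀ _ (by positivity)]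

theorem lamFun_congr {K L : Set (EuclideanSpace ℝ (Fin n))} (hf : frontier K = frontier L)
    (hv : volume K = volume L) : lamFun n K = lamFun n L := by
  simp only [lamFun, bmom, perim, vol, hf, hv]

theorem lamFun_closure {K : Set (EuclideanSpace ℝ (Fin n))} (hK : Convex ℝ K)
    (hne : (interior K).Nonempty) : lamFun n (closure K) = lamFun n K := by
  refine lamFun_congr ?_ (measure_closure_of_null_frontier (hK.addHaar_frontier volume))
  rw [frontier, closure_closure, hK.interior_closure_eq_interior_of_nonempty_interior hne, frontier]

theorem lamFun_interior {K : Set (EuclideanSpace ℝ (Fin n))} (hK : Convex ℝ K)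
    (hne : (interior K).Nonempty) : lamFun n (interior K) = lamFun n K := by
  refine lamFun_congr ?_ (measure_interior_of_null_frontier (hK.addHaar_frontier volume))
  rw [frontier, interior_interior, hK.closure_interior_eq_closure_of_nonempty_interior hne, frontier]

theorem vol_mono {K L : Set (EuclideanSpace ℝ (Fin n))} (h : K ⊆ L) (hL : IsBounded L) :
    vol n K ≤ vol n L :=
  ENNReal.toReal_mono hL.measure_lt_top.ne (measure_mono h)

theorem vol_image_smulAddHomeo {s : ℝ} (hs : 0 < s) (w : EuclideanSpace ℝ (Fin n))
    (K : Set (EuclideanSpace ℝ (Fin n))) :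
    vol n (smulAddHomeo s hs.ne' w '' K) = s ^ n * vol n K := by
  have h : smulAddHomeo s hs.ne' w '' K = (· + w) '' (s • K) := by
    rw [← image_smul, image_image]
    rfl
  rw [vol, vol, h, image_add_right, measure_preimage_add_right, Measure.addHaar_smul,
    finrank_euclideanSpace_fin, ENNReal.toReal_mul, ENNReal.toReal_ofReal (abs_nonneg _),
    abs_of_pos (pow_pos hs n)]

theorem pow_mul_rpow_two_div (hn : n ≠ 0) {s v : ℝ} (hs : 0 ≤ s) (hv : 0 ≤ v) :
    (s ^ n * v) ^ ((2 : ℝ) / n) = s ^ 2 * v ^ ((2 : ℝ) / n) := by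
  rw [Real.mul_rpow (pow_nonneg hs n) hv, ← Real.rpow_natCast s n, ← Real.rpow_mul hs,
    mul_div_cancel₀ _ (Nat.cast_ne_zero.2 hn), Real.rpow_two]

/-- A convex body: a compact convex set with nonempty interior. -/
structure IsConvexBody (K : Set (EuclideanSpace ℝ (Fin n))) : Prop where
  isCompact : IsCompact K
  convex : Convex ℝ K
  nonempty_interior : (interior K).Nonempty

theorem IsConvexBody.image_smulAddHomeo {K : Set (EuclideanSpace ℝ (Fin n))} (hK : IsConvexBody K)
    {s : ℝ} (hs : s ≠ 0) (w : EuclideanSpace ℝ (Fin n)) :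
    IsConvexBody (smulAddHomeo s hs w '' K) where
  isCompact := hK.isCompact.image (smulAddHomeo s hs w).continuous
  convex := by
    have := (hK.convex.smul s).translate w
    rwa [← image_smul, image_image, funext fun x => add_comm w (s • x)] at this
  nonempty_interior := by
    rw [← Homeomorph.image_interior]
    exact hK.nonempty_interior.image _

theorem lamFun_image_smulAddHomeo_le (hn : 1 ≤ n) {K : Set (EuclideanSpace ℝ (Fin n))}
    (hK : IsConvexBody K) {s : ℝ} (hs : 0 < s) {w : EuclideanSpace ℝ (Fin n)}
    (hw : ∀ x ∈ K, ‖s • x + w‖ ≤ s * ‖x‖) (hpos : 0 < lamFun n K)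
    (hpos' : 0 < lamFun n (smulAddHomeo s hs.ne' w '' K)) :
    lamFun n (smulAddHomeo s hs.ne' w '' K) ≤ lamFun n K := by
  have hn0 : n ≠ 0 := by omega
  have hd : (0 : ℝ) ≤ (n : ℝ) - 1 := by
    rw [sub_nonneg]
    exact_mod_cast hn
  set K' := smulAddHomeo s hs.ne' w '' K with hK'
  have hfr : frontier K' = smulAddHomeo s hs.ne' w '' frontier K :=
    ((smulAddHomeo s hs.ne' w).image_frontier K).symm
  have hP : perim n K ≤ s⁻¹ ^ ((n : ℝ) - 1) * perim n K' := by
    refine hausdorffMeasure_real_le_of_subset_image hd (inv_nonneg.2 hs.le)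
      (lipschitzWith_smulAddHomeo_symm hs w) ?_
      (hausdorffMeasure_frontier_ne_top_of_lamFun_pos hpos')
    rw [hfr, image_image]
    simp only [Homeomorph.symm_apply_apply, image_id', subset_refl]
  have hW : bmom n K' ≤ s ^ ((n : ℝ) - 1) * (s ^ 2 * bmom n K + 0 * perim n K) := by
    refine setIntegral_norm_sq_le_of_subset_image hd isClosed_frontier.measurableSet hs.le ?_
      hfr.subset (hausdorffMeasure_frontier_ne_top_of_lamFun_pos hpos)
      (hK.isCompact.isBounded.subset hK.isCompact.isClosed.frontier_subset) (by positivity) le_rfl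
      fun x hx => ?_
    · refine LipschitzWith.of_dist_le_mul fun x y => ?_
      rw [smulAddHomeo_apply, smulAddHomeo_apply, dist_add_right, dist_smul₀,
        Real.norm_of_nonneg hs.le, Real.coe_toNNReal _ hs.le]
    · rw [add_zero, ← mul_pow]
      exact pow_le_pow_left₀ (norm_nonneg _) (hw x (hK.isCompact.isClosed.frontier_subset hx)) 2
  have hV : vol n K' ^ ((2 : ℝ) / n) = s ^ 2 * vol n K ^ ((2 : ℝ) / n) := by
    rw [hK', vol_image_smulAddHomeo hs, pow_mul_rpow_two_div hn0 hs.le (vol_nonneg K)]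
  have hP0 := perim_pos_of_lamFun_pos hpos
  have hP0' := perim_pos_of_lamFun_pos hpos'
  have hV0 := Real.rpow_pos_of_pos (vol_pos_of_lamFun_pos hn0 hpos) ((2 : ℝ) / n)
  have hW0 := bmom_nonneg K
  have hsd : 0 < s ^ ((n : ℝ) - 1) := Real.rpow_pos_of_pos hs _
  have hWP : bmom n K' * perim n K ≤ s ^ 2 * bmom n K * perim n K' := by
    calc bmom n K' * perim n K
        ≤ (s ^ ((n : ℝ) - 1) * (s ^ 2 * bmom n K + 0 * perim n K)) *
            (s⁻¹ ^ ((n : ℝ) - 1) * perim n K') := by gcongr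
      _ = s ^ 2 * bmom n K * perim n K' := by
        rw [Real.inv_rpow hs.le]
        field_simp
        ring
  rw [lamFun, lamFun, hV, div_le_div_iff₀ (by positivity) (by positivity)]
  calc bmom n K' * (perim n K * vol n K ^ ((2 : ℝ) / n))
      = bmom n K' * perim n K * vol n K ^ ((2 : ℝ) / n) := by ring
    _ ≤ s ^ 2 * bmom n K * perim n K' * vol n K ^ ((2 : ℝ) / n) := by gcongr
    _ = _ := by ring

/-- Translating the nearest point to the origin and rescaling normalizes a convex body without
increasing `lamFun`. -/
theorem exists_normalized_lamFun_le (hn : 1 ≤ n)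
    (hpos : ∀ K : Set (EuclideanSpace ℝ (Fin n)), IsConvexBody K → 0 < lamFun n K)
    {K : Set (EuclideanSpace ℝ (Fin n))} (hK : IsConvexBody K) :
    ∃ L : Set (EuclideanSpace ℝ (Fin n)), IsConvexBody L ∧ lamFun n L ≤ lamFun n K ∧
      (0 : EuclideanSpace ℝ (Fin n)) ∈ L ∧ L ⊆ closedBall 0 1 ∧ ∃ y ∈ L, ‖y‖ = 1 := by
  have : NeZero n := ⟨by omega⟩
  have hKne : K.Nonempty := hK.nonempty_interior.mono interior_subset
  obtain ⟨p, hlip, hmem, hfix, -⟩ :=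
    exists_nearest_point_map hK.isCompact.isClosed hK.convex hKne
  set z := p 0
  have hz : ∀ x ∈ K, ‖x - z‖ ≤ ‖x‖ := fun x hx => by
    simpa [hfix x hx, dist_eq_norm] using hlip.dist_le_mul x 0
  obtain ⟨y, hy, hmax⟩ := hK.isCompact.exists_isMaxOn hKne
    (f := fun x => ‖x - z‖) (by fun_prop)
  have hR : 0 < ‖y - z‖ := by
    refine (norm_nonneg _).lt_of_ne' fun h0 => ?_
    have hsub : K ⊆ {z} := fun x hx => by
      have h1 : ‖x - z‖ ≤ ‖y - z‖ := hmax hx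
      rw [h0] at h1
      exact sub_eq_zero.1 (norm_le_zero_iff.1 h1)
    have h1 := hK.nonempty_interior.mono (interior_mono hsub)
    rw [interior_singleton] at h1
    exact not_nonempty_empty h1
  set s := ‖y - z‖⁻¹ with hsdef
  have hs : 0 < s := inv_pos.2 hR
  have happ : ∀ x, smulAddHomeo s hs.ne' (-(s • z)) x = s • (x - z) := fun x => by
    rw [smulAddHomeo_apply, smul_sub, sub_eq_add_neg]
  have hL := hK.image_smulAddHomeo hs.ne' (-(s • z))
  refine ⟨_, hL, lamFun_image_smulAddHomeo_le hn hK hs (fun x hx => ?_) (hpos K hK) (hpos _ hL),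
    ⟨z, hmem 0, ?_⟩, ?_, _, ⟨y, hy, rfl⟩, ?_⟩
  · rw [← smulAddHomeo_apply s hs.ne', happ, norm_smul, Real.norm_of_nonneg hs.le]
    exact mul_le_mul_of_nonneg_left (hz x hx) hs.le
  · rw [happ, sub_self, smul_zero]
  · rintro _ ⟨x, hx, rfl⟩
    rw [happ, mem_closedBall_zero_iff, norm_smul, Real.norm_of_nonneg hs.le, hsdef,
      inv_mul_le_iff₀ hR, mul_one]
    exact hmax hx
  · rw [happ, norm_smul, Real.norm_of_nonneg hs.le, hsdef, inv_mul_cancel₀ hR.ne']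

/-- A fixed fraction of the surface of a normalized convex body is far from the origin. -/
theorem perim_le_bmom_of_normalized (hn : 1 ≤ n) {K : Set (EuclideanSpace ℝ (Fin n))}
    (hK : IsConvexBody K) (hpos : 0 < lamFun n K) (hb : K ⊆ closedBall 0 1)
    {y : EuclideanSpace ℝ (Fin n)} (hy : y ∈ K) (hy1 : ‖y‖ = 1) :
    perim n K ≤ 8 * 4 ^ ((n : ℝ) - 1) * bmom n K := by
  have hd : (0 : ℝ) ≤ (n : ℝ) - 1 := by
    rw [sub_nonneg]
    exact_mod_cast hn
  obtain ⟨g, q, hg, hq, hcov⟩ := exists_frontier_cover_halfSpace hK.isCompact.isClosed hK.convex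
    hK.nonempty_interior hb hy hy1
  set T := frontier K ∩ {x | 1 / 2 ≤ inner ℝ y x}
  have htop := hausdorffMeasure_frontier_ne_top_of_lamFun_pos hpos
  have hTtop : μH[(n : ℝ) - 1] T ≠ ⊤ := ne_top_of_le_ne_top htop (measure_mono inter_subset_left)
  have hTm : MeasurableSet T := isClosed_frontier.measurableSet.inter
    (isClosed_le continuous_const (by fun_prop)).measurableSet
  have hqT : μH[(n : ℝ) - 1] (q '' T) ≤ μH[(n : ℝ) - 1] T := by
    simpa using hq.hausdorffMeasure_image_le hd T
  have hU : μH[(n : ℝ) - 1] (T ∪ q '' T) ≤ 2 * μH[(n : ℝ) - 1] T := by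
    rw [two_mul]
    exact (measure_union_le _ _).trans (add_le_add le_rfl hqT)
  have h2top : 2 * μH[(n : ℝ) - 1] T ≠ ⊤ := ENNReal.mul_ne_top ENNReal.ofNat_ne_top hTtop
  have h1 : perim n K ≤ (4⁻¹ : ℝ)⁻¹ ^ ((n : ℝ) - 1) * (μH[(n : ℝ) - 1] (T ∪ q '' T)).toReal :=
    hausdorffMeasure_real_le_of_subset_image hd (by norm_num) hg hcov
      (ne_top_of_le_ne_top h2top hU)
  have h2 : (μH[(n : ℝ) - 1] (T ∪ q '' T)).toReal ≤ 2 * (μH[(n : ℝ) - 1] T).toReal := by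
    simpa using ENNReal.toReal_mono h2top hU
  have hint := integrableOn_norm_sq isClosed_frontier.measurableSet htop
    (hK.isCompact.isBounded.subset hK.isCompact.isClosed.frontier_subset)
  have h3 : 1 / 4 * (μH[(n : ℝ) - 1] T).toReal ≤ bmom n K := by
    refine (setIntegral_ge_of_const_le_real hTm hTtop (fun x hx => ?_)
      (hint.mono_set inter_subset_left)).trans
      (setIntegral_mono_set hint (Filter.Eventually.of_forall fun x => by positivity)
        inter_subset_left.eventuallyLE)
    have h4 := real_inner_le_norm y x
    rw [hy1, one_mul] at h4
    have h5 : 1 / 2 ≤ ‖x‖ := le_trans hx.2 h4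
    nlinarith
  have h4 : (0 : ℝ) < 4 ^ ((n : ℝ) - 1) := Real.rpow_pos_of_pos (by norm_num) _
  rw [inv_inv] at h1
  nlinarith [mul_le_mul_of_nonneg_left h2 h4.le, mul_le_mul_of_nonneg_left h3 h4.le]

theorem one_le_lamFun_mul_of_normalized (hn : 1 ≤ n) {K : Set (EuclideanSpace ℝ (Fin n))}
    (hK : IsConvexBody K) (hpos : 0 < lamFun n K) (hb : K ⊆ closedBall 0 1)
    {y : EuclideanSpace ℝ (Fin n)} (hy : y ∈ K) (hy1 : ‖y‖ = 1) :
    1 ≤ 8 * 4 ^ ((n : ℝ) - 1) * (lamFun n K * vol n K ^ ((2 : ℝ) / n)) := by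
  have h := perim_le_bmom_of_normalized hn hK hpos hb hy hy1
  rw [bmom_eq_lamFun_mul (by omega) hpos] at h
  refine le_of_mul_le_mul_right ?_ (perim_pos_of_lamFun_pos hpos)
  linarith

/-- Quantitative lower semicontinuity of `lamFun` with respect to the Hausdorff distance. -/
theorem bmom_le_of_close (hn : 1 ≤ n) {K L : Set (EuclideanSpace ℝ (Fin n))}
    (hK : IsConvexBody K) (hL : IsConvexBody L) (hKpos : 0 < lamFun n K) (hLpos : 0 < lamFun n L)
    (h0 : (0 : EuclideanSpace ℝ (Fin n)) ∈ K) (hKb : K ⊆ closedBall 0 1)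
    (hLb : L ⊆ closedBall 0 1) {x₀ : EuclideanSpace ℝ (Fin n)} {r δ s : ℝ} (hr0 : 0 ≤ r)
    (hs : 0 < s) (hs1 : s < 1) (hδ : δ ≤ (1 - s) * r) (hr : closedBall x₀ r ⊆ K)
    (hKL : ∀ x ∈ K, ∃ l ∈ L, dist x l ≤ δ) (hLK : ∀ x ∈ L, ∃ k ∈ K, dist x k ≤ δ) :
    bmom n K ≤ s⁻¹ ^ ((n : ℝ) - 1) * (s⁻¹ ^ 2 * (s⁻¹ ^ ((n : ℝ) - 1) * perim n K *
      (lamFun n L * (s⁻¹ ^ 2 * vol n K ^ ((2 : ℝ) / n)) + 3 * (1 - s)))) := by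
  have hn0 : n ≠ 0 := by omega
  have hd : (0 : ℝ) ≤ (n : ℝ) - 1 := by
    rw [sub_nonneg]
    exact_mod_cast hn
  have hs' : 0 ≤ s⁻¹ := inv_nonneg.2 hs.le
  have h1s : 0 < 1 - s := by linarith
  have hKcl := hK.isCompact.isClosed
  have hLcl := hL.isCompact.isClosed
  have hfrL : frontier L ⊆ L := hLcl.frontier_subset
  have hKtop := hausdorffMeasure_frontier_ne_top_of_lamFun_pos hKpos
  have hLtop := hausdorffMeasure_frontier_ne_top_of_lamFun_pos hLpos
  have hLmem : ∀ x ∈ L, s • x + (1 - s) • x₀ ∈ K := fun x hx =>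
    smul_add_mem_of_close_to hK.convex hs hs1 hδ hr hLK hx
  have hKmem : ∀ x ∈ K, s • x + (1 - s) • x₀ ∈ L := fun x hx =>
    smul_add_mem_of_close_from hK.convex hLcl hL.convex (hL.nonempty_interior.mono interior_subset)
      hr0 hs hs1 hδ hr hKL hx
  have hP : perim n L ≤ s⁻¹ ^ ((n : ℝ) - 1) * perim n K := by
    obtain ⟨g, hg, hcov, -⟩ := exists_lipschitz_frontier_cover hLcl hL.convex
      hL.nonempty_interior hK.isCompact.isBounded hs _ hLmem
    exact hausdorffMeasure_real_le_of_subset_image hd hs' hg hcov hKtop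
  have hV : s ^ n * vol n L ≤ vol n K := by
    rw [← vol_image_smulAddHomeo hs ((1 - s) • x₀)]
    refine vol_mono ?_ hK.isCompact.isBounded
    rintro _ ⟨x, hx, rfl⟩
    exact hLmem x hx
  have hV' : vol n L ^ ((2 : ℝ) / n) ≤ s⁻¹ ^ 2 * vol n K ^ ((2 : ℝ) / n) := by
    have h1 := Real.rpow_le_rpow (mul_nonneg (pow_nonneg hs.le n) (vol_nonneg L)) hV
      (by positivity : (0 : ℝ) ≤ 2 / n)
    rw [pow_mul_rpow_two_div hn0 hs.le (vol_nonneg L)] at h1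
    rwa [inv_pow, le_inv_mul_iff₀ (by positivity)]
  have hW : bmom n K ≤ s⁻¹ ^ ((n : ℝ) - 1) *
      (s⁻¹ ^ 2 * bmom n L + s⁻¹ ^ 2 * (3 * (1 - s)) * perim n L) := by
    obtain ⟨g, hg, hcov, hgb⟩ := exists_lipschitz_frontier_cover hKcl hK.convex
      hK.nonempty_interior hL.isCompact.isBounded hs _ hKmem
    refine setIntegral_norm_sq_le_of_subset_image hd isClosed_frontier.measurableSet hs' hg hcov
      hLtop (hL.isCompact.isBounded.subset hfrL) (by positivity) (by positivity) fun x hx => ?_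
    have hx1 : ‖x‖ ≤ 1 := by simpa using hLb (hfrL hx)
    have hx₀ : ‖x₀‖ ≤ 1 := by simpa using hKb (hr (mem_closedBall_self hr0))
    have h1 : ‖x - (1 - s) • x₀‖ ≤ ‖x‖ + (1 - s) := by
      refine (norm_sub_le _ _).trans ?_
      rw [norm_smul, Real.norm_of_nonneg h1s.le]
      nlinarith
    calc ‖g x‖ ^ 2 ≤ (s⁻¹ * (‖x‖ + (1 - s))) ^ 2 := by
          gcongr
          exact (hgb h0 x).trans (mul_le_mul_of_nonneg_left h1 hs')
      _ = s⁻¹ ^ 2 * (‖x‖ + (1 - s)) ^ 2 := mul_pow _ _ _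
      _ ≤ s⁻¹ ^ 2 * (‖x‖ ^ 2 + 3 * (1 - s)) := by
          gcongr
          nlinarith [norm_nonneg x]
      _ = s⁻¹ ^ 2 * ‖x‖ ^ 2 + s⁻¹ ^ 2 * (3 * (1 - s)) := mul_add _ _ _
  refine hW.trans ?_
  have hlam := lamFun_nonneg L
  have hPL := perim_nonneg L
  have hVK := Real.rpow_nonneg (vol_nonneg K) ((2 : ℝ) / n)
  have hsP : 0 ≤ s⁻¹ ^ ((n : ℝ) - 1) * perim n K :=
    mul_nonneg (Real.rpow_nonneg hs' _) (perim_nonneg K)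
  have hsum : 0 ≤ lamFun n L * vol n L ^ ((2 : ℝ) / n) + 3 * (1 - s) :=
    add_nonneg (mul_nonneg hlam (Real.rpow_nonneg (vol_nonneg L) _)) (by positivity)
  rw [bmom_eq_lamFun_mul hn0 hLpos]
  calc s⁻¹ ^ ((n : ℝ) - 1) * (s⁻¹ ^ 2 * (lamFun n L * (perim n L * vol n L ^ ((2 : ℝ) / n))) +
        s⁻¹ ^ 2 * (3 * (1 - s)) * perim n L)
      = s⁻¹ ^ ((n : ℝ) - 1) * (s⁻¹ ^ 2 * (perim n L *
          (lamFun n L * vol n L ^ ((2 : ℝ) / n) + 3 * (1 - s)))) := by ring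
    _ ≤ _ := by gcongr

/-- `lamFun` is lower semicontinuous along sequences of convex bodies in the unit ball converging in
the Hausdorff distance to a convex body containing the origin. -/
theorem lamFun_le_of_tendsto (hn : 1 ≤ n) {K : Set (EuclideanSpace ℝ (Fin n))}
    {L : ℕ → Set (EuclideanSpace ℝ (Fin n))} (hK : IsConvexBody K) (hL : ∀ k, IsConvexBody (L k))
    (hKpos : 0 < lamFun n K) (hLpos : ∀ k, 0 < lamFun n (L k))
    (h0 : (0 : EuclideanSpace ℝ (Fin n)) ∈ K) (hKb : K ⊆ closedBall 0 1)
    (hLb : ∀ k, L k ⊆ closedBall 0 1)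
    (hKL : ∀ δ > 0, ∀ᶠ k in Filter.atTop, ∀ x ∈ K, ∃ l ∈ L k, dist x l ≤ δ)
    (hLK : ∀ δ > 0, ∀ᶠ k in Filter.atTop, ∀ x ∈ L k, ∃ l ∈ K, dist x l ≤ δ) {m : ℝ}
    (hm : Filter.Tendsto (fun k => lamFun n (L k)) Filter.atTop (𝓝 m)) : lamFun n K ≤ m := by
  obtain ⟨x₀, hx₀⟩ := hK.nonempty_interior
  obtain ⟨r, hr0, hr⟩ := Metric.nhds_basis_closedBall.mem_iff.1 (mem_interior_iff_mem_nhds.1 hx₀)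
  set F : ℝ → ℝ → ℝ := fun s l => s⁻¹ ^ ((n : ℝ) - 1) * (s⁻¹ ^ 2 * (s⁻¹ ^ ((n : ℝ) - 1) *
    perim n K * (l * (s⁻¹ ^ 2 * vol n K ^ ((2 : ℝ) / n)) + 3 * (1 - s)))) with hF
  have hlim : ∀ s : ℝ, 0 < s → s < 1 → bmom n K ≤ F s m := fun s hs hs1 => by
    have hδ : 0 < (1 - s) * r := mul_pos (by linarith) hr0
    have hcont : Continuous (F s) := by fun_prop
    refine ge_of_tendsto ((hcont.tendsto m).comp hm) ?_
    filter_upwards [hKL _ hδ, hLK _ hδ] with k h1 h2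
    exact bmom_le_of_close hn hK (hL k) hKpos (hLpos k) h0 hKb (hLb k) hr0.le hs hs1 le_rfl hr h1 h2
  have hinv : ContinuousAt (fun s : ℝ => s⁻¹) 1 := continuousAt_inv₀ one_ne_zero
  have hrpow : ContinuousAt (fun s : ℝ => s⁻¹ ^ ((n : ℝ) - 1)) 1 :=
    hinv.rpow_const (Or.inl (by norm_num))
  have hF1 : ContinuousAt (fun s => F s m) 1 := by
    refine hrpow.mul ((hinv.pow 2).mul ((hrpow.mul continuousAt_const).mul
      ((continuousAt_const.mul ((hinv.pow 2).mul continuousAt_const)).add ?_)))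
    fun_prop
  have h1 : bmom n K ≤ F 1 m := by
    refine ge_of_tendsto (hF1.tendsto.mono_left (nhdsWithin_le_nhds (s := Iio 1))) ?_
    filter_upwards [Ioo_mem_nhdsLT (zero_lt_one (α := ℝ))] with s hs
    exact hlim s hs.1 hs.2
  have hP := perim_pos_of_lamFun_pos hKpos
  have hV := Real.rpow_pos_of_pos (vol_pos_of_lamFun_pos (by omega) hKpos) ((2 : ℝ) / n)
  rw [lamFun, div_le_iff₀ (by positivity)]
  refine h1.trans_eq ?_
  simp only [hF, inv_one, Real.one_rpow, one_pow, one_mul, sub_self, mul_zero, add_zero]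
  ring

theorem exists_isConvexBody_lamFun_le (hn : 1 ≤ n)
    (hpos : ∀ K : Set (EuclideanSpace ℝ (Fin n)), IsConvexBody K → 0 < lamFun n K) :
    ∃ K : Set (EuclideanSpace ℝ (Fin n)), IsConvexBody K ∧
      ∀ L : Set (EuclideanSpace ℝ (Fin n)), IsConvexBody L → lamFun n K ≤ lamFun n L := by
  set S : Set ℝ := lamFun n '' {K | IsConvexBody K}
  have hSne : S.Nonempty := by
    refine ⟨_, closedBall 0 1, ⟨isCompact_closedBall 0 1, convex_closedBall 0 1, 0, ?_⟩, rfl⟩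
    exact ball_subset_interior_closedBall (mem_ball_self one_pos)
  have hSb : BddBelow S := ⟨0, by
    rintro _ ⟨K, -, rfl⟩
    exact lamFun_nonneg K⟩
  set m := sInf S
  have hm : ∀ K : Set (EuclideanSpace ℝ (Fin n)), IsConvexBody K → m ≤ lamFun n K :=
    fun K hK => csInf_le hSb ⟨K, hK, rfl⟩
  obtain ⟨u, -, hu, huS⟩ := exists_seq_tendsto_sInf hSne hSb
  choose K₀ hK₀ hK₀u using huS
  choose L hL hLle hL0 hLb y hyL hy1 using fun k => exists_normalized_lamFun_le hn hpos (hK₀ k)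
  have hlim : Filter.Tendsto (fun k => lamFun n (L k)) Filter.atTop (𝓝 m) :=
    tendsto_of_tendsto_of_tendsto_of_le_of_le tendsto_const_nhds hu (fun k => hm _ (hL k))
      fun k => (hLle k).trans_eq (hK₀u k)
  set C : ℕ → TopologicalSpace.NonemptyCompacts (EuclideanSpace ℝ (Fin n)) := fun k =>
    ⟨⟨L k, (hL k).isCompact⟩, ⟨0, hL0 k⟩⟩
  obtain ⟨K, hKb, φ, hφ, hconv⟩ :=
    (TopologicalSpace.NonemptyCompacts.isCompact_subsets_of_isCompact
      (isCompact_closedBall (0 : EuclideanSpace ℝ (Fin n)) 1)).tendsto_subseq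
      (x := C) (fun k => hLb k)
  have hclose : ∀ δ > 0, ∀ᶠ k in Filter.atTop,
      (∀ x ∈ (K : Set (EuclideanSpace ℝ (Fin n))), ∃ l ∈ L (φ k), dist x l ≤ δ) ∧
      ∀ x ∈ L (φ k), ∃ l ∈ (K : Set (EuclideanSpace ℝ (Fin n))), dist x l ≤ δ := fun δ hδ => by
    filter_upwards [Metric.tendsto_nhds.1 hconv δ hδ] with k hk
    have hk' : hausdorffDist (L (φ k)) (K : Set (EuclideanSpace ℝ (Fin n))) < δ := hk
    have hfin : hausdorffEDist (L (φ k)) (K : Set (EuclideanSpace ℝ (Fin n))) ≠ ⊤ :=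
      hausdorffEDist_ne_top_of_nonempty_of_bounded ⟨0, hL0 _⟩ K.nonempty
        (hL _).isCompact.isBounded K.isCompact.isBounded
    refine ⟨fun x hx => ?_, fun x hx => ?_⟩
    · obtain ⟨l, hl, hd⟩ := exists_dist_lt_of_hausdorffDist_lt' hx hk' hfin
      exact ⟨l, hl, by rw [dist_comm]; exact hd.le⟩
    · obtain ⟨l, hl, hd⟩ := exists_dist_lt_of_hausdorffDist_lt hx hk' hfin
      exact ⟨l, hl, hd.le⟩
  have hmemK : ∀ x, (∀ δ > 0, ∃ l ∈ (K : Set (EuclideanSpace ℝ (Fin n))), dist x l ≤ δ) →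
      x ∈ (K : Set (EuclideanSpace ℝ (Fin n))) := fun x hx => by
    rw [← K.isCompact.isClosed.closure_eq, Metric.mem_closure_iff]
    intro ε hε
    obtain ⟨l, hl, hd⟩ := hx (ε / 2) (half_pos hε)
    exact ⟨l, hl, by linarith⟩
  have h0 : (0 : EuclideanSpace ℝ (Fin n)) ∈ (K : Set (EuclideanSpace ℝ (Fin n))) :=
    hmemK 0 fun δ hδ => by
      obtain ⟨k, -, hk⟩ := (hclose δ hδ).exists
      exact hk 0 (hL0 _)
  have hKconv : Convex ℝ (K : Set (EuclideanSpace ℝ (Fin n))) := by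
    intro x hx z hz a b ha hb hab
    refine hmemK _ fun δ hδ => ?_
    obtain ⟨k, hk1, hk2⟩ := (hclose (δ / 2) (half_pos hδ)).exists
    obtain ⟨x', hx', hxd⟩ := hk1 x hx
    obtain ⟨z', hz', hzd⟩ := hk1 z hz
    obtain ⟨l, hl, hld⟩ := hk2 _ ((hL (φ k)).convex hx' hz' ha hb hab)
    refine ⟨l, hl, (dist_triangle _ (a • x' + b • z') _).trans ?_⟩
    have h1 : dist (a • x + b • z) (a • x' + b • z') ≤ δ / 2 := by
      refine (dist_add_add_le _ _ _ _).trans ?_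
      rw [dist_smul₀, dist_smul₀, Real.norm_of_nonneg ha, Real.norm_of_nonneg hb]
      nlinarith
    linarith
  have hKvol : 0 < vol n (K : Set (EuclideanSpace ℝ (Fin n))) := by
    have hm0 : 0 ≤ m := le_csInf hSne (by
      rintro _ ⟨K, -, rfl⟩
      exact lamFun_nonneg K)
    set c : ℝ := 8 * 4 ^ ((n : ℝ) - 1)
    have hc0 : 0 < c := mul_pos (by norm_num) (Real.rpow_pos_of_pos (by norm_num) _)
    have hthick : Filter.Tendsto (fun δ : ℝ =>
        vol n (cthickening δ (K : Set (EuclideanSpace ℝ (Fin n))))) (𝓝[>] 0)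
        (𝓝 (vol n (K : Set (EuclideanSpace ℝ (Fin n))))) :=
      ((ENNReal.tendsto_toReal K.isCompact.measure_lt_top.ne).comp
        (tendsto_measure_cthickening_of_isCompact K.isCompact)).mono_left nhdsWithin_le_nhds
    have hexp : (0 : ℝ) ≤ 2 / n := by positivity
    have hle : 1 ≤ c * ((m + 1) * vol n (K : Set (EuclideanSpace ℝ (Fin n))) ^ ((2 : ℝ) / n)) := by
      refine ge_of_tendsto (((hthick.rpow_const (Or.inr hexp)).const_mul (m + 1)).const_mul c) ?_
      filter_upwards [self_mem_nhdsWithin] with δ hδ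
      obtain ⟨k, ⟨-, hk⟩, hkm⟩ := ((hclose δ hδ).and
        ((hlim.comp hφ.tendsto_atTop).eventually_lt_const (lt_add_one m))).exists
      refine (one_le_lamFun_mul_of_normalized hn (hL (φ k)) (hpos _ (hL _)) (hLb _)
        (hyL _) (hy1 _)).trans ?_
      refine mul_le_mul_of_nonneg_left (mul_le_mul hkm.le (Real.rpow_le_rpow (vol_nonneg _) ?_ hexp)
        (Real.rpow_nonneg (vol_nonneg _) _) (by linarith)) hc0.le
      refine vol_mono (fun x hx => ?_) K.isCompact.isBounded.cthickening
      obtain ⟨l, hl, hd⟩ := hk x hx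
      exact mem_cthickening_of_dist_le x l δ _ hl hd
    refine (vol_nonneg _).lt_of_ne' fun hv => ?_
    have hexp0 : (2 : ℝ) / n ≠ 0 := by positivity
    rw [hv, Real.zero_rpow hexp0, mul_zero, mul_zero] at hle
    linarith
  have hKbody : IsConvexBody (K : Set (EuclideanSpace ℝ (Fin n))) := by
    refine ⟨K.isCompact, hKconv, ?_⟩
    by_contra hempty
    rw [not_nonempty_iff_eq_empty] at hempty
    have hfr := hKconv.addHaar_frontier volume
    rw [frontier, hempty, sdiff_empty, K.isCompact.isClosed.closure_eq] at hfr
    rw [vol, hfr] at hKvol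
    simp at hKvol
  refine ⟨K, hKbody, fun M hM => (lamFun_le_of_tendsto hn hKbody (fun k => hL (φ k))
    (hpos _ hKbody) (fun k => hpos _ (hL _)) h0 hKb (fun k => hLb _)
    (fun δ hδ => (hclose δ hδ).mono fun k hk => hk.1)
    (fun δ hδ => (hclose δ hδ).mono fun k hk => hk.2) (hlim.comp hφ.tendsto_atTop)).trans (hm M hM)⟩

end Functional

/-- the infimum of `λ` over the class of bounded open convex sets is attained. -/
theorem lam_minimizer_exists (n : ℕ) (hn : 2 ≤ n) :
    ∃ Ω₀ : Set (EuclideanSpace ℝ (Fin n)),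
      IsBounded Ω₀ ∧ IsOpen Ω₀ ∧ Convex ℝ Ω₀ ∧ (interior Ω₀).Nonempty ∧
      ∀ Ω : Set (EuclideanSpace ℝ (Fin n)),
        IsBounded Ω → IsOpen Ω → Convex ℝ Ω → (interior Ω).Nonempty →
          lamFun n Ω₀ ≤ lamFun n Ω := by
  by_cases hpos : ∀ K : Set (EuclideanSpace ℝ (Fin n)), IsConvexBody K → 0 < lamFun n K
  · obtain ⟨K, hK, hmin⟩ := exists_isConvexBody_lamFun_le (by omega) hpos
    refine ⟨interior K, hK.isCompact.isBounded.subset interior_subset, isOpen_interior,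
      hK.convex.interior, by simpa using hK.nonempty_interior, fun Ω hb _ hc hne => ?_⟩
    rw [lamFun_interior hK.convex hK.nonempty_interior, ← lamFun_closure hc hne]
    exact hmin _ ⟨hb.isCompact_closure, hc.closure, hne.mono (interior_mono subset_closure)⟩
  · push Not at hpos
    obtain ⟨K, hK, hle⟩ := hpos
    refine ⟨interior K, hK.isCompact.isBounded.subset interior_subset, isOpen_interior,
      hK.convex.interior, by simpa using hK.nonempty_interior, fun Ω _ _ _ _ => ?_⟩
    rw [lamFun_interior hK.convex hK.nonempty_interior]
    exact hle.trans (lamFun_nonneg Ω)
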